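/- (Proposition 2, main estimate) For the two-machine three-job instance above, every non-delay feasible schedule σ satisfies Lmax(σ) ≥ 2a + 1. -/

import Mathlib

/-- A feasible (non-preemptive) open shop schedule. -/
def OpenShopFeasible (m n : ℕ) (p s : Fin m → Fin n → ℝ) : Prop :=
  (∀ i j, 0 ≤ s i j) ∧
  (∀ i : Fin m, ∀ j j' : Fin n, j ≠ j' → 0 < p i j → 0 < p i j' →
    Disjoint (Set.Ico (s i j) (s i j + p i j)) (Set.Ico (s i j') (s i j' + p i j'))) ∧
  (∀ j : Fin n, ∀ i i' : Fin m, i ≠ i' → 0 < p i j → 0 < p i' j →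
    Disjoint (Set.Ico (s i j) (s i j + p i j)) (Set.Ico (s i' j) (s i' j + p i' j)))

/-- A non-delay (list) schedule: no machine is idle while an operation is available. -/
def OpenShopNonDelay (m n : ℕ) (p s : Fin m → Fin n → ℝ) : Prop :=
  ¬ ∃ (i : Fin m) (j : Fin n) (t : ℝ), 0 < p i j ∧ 0 ≤ t ∧ t < s i j ∧
      (∀ j' : Fin n, 0 < p i j' → t ∉ Set.Ico (s i j') (s i j' + p i j')) ∧
      (∀ i' : Fin m, 0 < p i' j → t ∉ Set.Ico (s i' j) (s i' j + p i' j))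

/-- The maximum lateness of a schedule. -/
noncomputable def OpenShopLmax (m n : ℕ) (p s : Fin m → Fin n → ℝ) (q : Fin n → ℝ) : ℝ :=
  ⨆ j : Fin n, ((⨆ i : Fin m, (s i j + p i j)) + q j)

theorem add_le_or_add_le_of_disjoint_Ico {x y c d : ℝ} (hc : 0 < c) (hd : 0 < d)
    (h : Disjoint (Set.Ico x (x + c)) (Set.Ico y (y + d))) : x + c ≤ y ∨ y + d ≤ x := by
  rw [Set.Ico_disjoint_Ico, min_le_iff, le_max_iff, le_max_iff] at h
  grind

theorem le_openShopLmax {m n : ℕ} (p s : Fin m → Fin n → ℝ) (q : Fin n → ℝ)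
    (i : Fin m) (j : Fin n) : s i j + p i j + q j ≤ OpenShopLmax m n p s q :=
  (add_le_add_left (le_ciSup (f := fun i => s i j + p i j) (Set.finite_range _).bddAbove i)
    (q j)).trans
    (le_ciSup (f := fun j => (⨆ i, (s i j + p i j)) + q j) (Set.finite_range _).bddAbove j)

/-- Proposition 2 (main estimate): for the instance with `p 1 1 = a`, `p 2 2 = a`,
`p 1 3 = p 2 3 = 1` (other processing times zero) and delivery times `q 1 = q 2 = 0`,
`q 3 = a`, every non-delay feasible schedule has maximum lateness at least `2a + 1`. -/
theorem hard_instance_list_lower_bound (a : ℝ) (ha : 1 ≤ a)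
    (s : Fin 2 → Fin 3 → ℝ)
    (hs : OpenShopFeasible 2 3 ![![a, 0, 1], ![0, a, 1]] s)
    (hnd : OpenShopNonDelay 2 3 ![![a, 0, 1], ![0, a, 1]] s) :
    2 * a + 1 ≤ OpenShopLmax 2 3 ![![a, 0, 1], ![0, a, 1]] s ![0, 0, a] := by
  have ha0 : 0 < a := by linarith
  obtain ⟨hnonneg, hmach, hjob⟩ := hs
  have hL₀ := le_openShopLmax ![![a, 0, 1], ![0, a, 1]] s ![0, 0, a] 0 2
  have hL₁ := le_openShopLmax ![![a, 0, 1], ![0, a, 1]] s ![0, 0, a] 1 2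
  have hM₀ := hmach 0 0 2 (by decide) (by simpa) (by simp)
  have hM₁ := hmach 1 1 2 (by decide) (by simpa) (by simp)
  have hJ := hjob 2 0 1 (by decide) (by simp) (by simp)
  simp only [Matrix.cons_val] at hL₀ hL₁ hM₀ hM₁ hJ
  replace hM₀ := add_le_or_add_le_of_disjoint_Ico ha0 one_pos hM₀
  replace hM₁ := add_le_or_add_le_of_disjoint_Ico ha0 one_pos hM₁
  replace hJ := add_le_or_add_le_of_disjoint_Ico one_pos one_pos hJ
  have h00 := hnonneg 0 0
  have h02 := hnonneg 0 2
  have h11 := hnonneg 1 1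
  have h12 := hnonneg 1 2
  by_contra! hlt
  apply hnd
  rcases hJ with hJ | hJ
  · have hy : s 1 2 + 1 ≤ s 1 1 := hM₁.resolve_left (by linarith)
    refine ⟨1, 1, 0, by simpa, le_rfl, by linarith, ?_, ?_⟩ <;>
    · simp only [Fin.forall_fin_succ, Set.mem_Ico]
      simp
      grind
  · have hx : s 0 2 + 1 ≤ s 0 0 := hM₀.resolve_left (by linarith)
    refine ⟨0, 0, 0, by simpa, le_rfl, by linarith, ?_, ?_⟩ <;>
    · simp only [Fin.forall_fin_succ, Set.mem_Ico]
      simp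
      grind
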